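/- Let F₀ be a fundamental face of H and let W(F₀) = {w ∈ W : wF₀ = F₀}. Then for every face F of H with F ⊆ F₀ there exists w ∈ W(F₀) such that wF is a fundamental face of H contained in F₀; and this fundamental face is unique: if wF and w'F are both fundamental faces for some w, w' ∈ W(F₀), then wF = w'F. -/

import Mathlib

open Set Module

noncomputable section

/-- The linear reflection `x ↦ x - f x • a` associated to a vector `a` and a linear
functional `f` with `f a = 2`, bundled as a linear automorphism. -/
def reflEquiv {V : Type*} [AddCommGroup V] [Module ℝ V]
    (a : V) (f : V →ₗ[ℝ] ℝ) (h2 : f a = 2) : V ≃ₗ[ℝ] V :=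
  LinearEquiv.ofInvolutive (LinearMap.id - f.smulRight a)
    (fun x => by
      simp only [LinearMap.sub_apply, LinearMap.id_apply, LinearMap.smulRight_apply,
        map_sub, map_smul, smul_eq_mul, h2]
      module)

/-- A realization over `ℝ` of an `m × m` generalized Cartan matrix `A`:
simple roots `α_i`, simple coroots `α_i∨` (as linear functionals), with
`⟨α_j, α_i∨⟩ = a_{ij}`, together with the defining axioms. -/
structure GCMRealization (m : ℕ) (V : Type*) [NormedAddCommGroup V] [NormedSpace ℝ V] where
  A : Matrix (Fin m) (Fin m) ℤ
  root : Fin m → V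
  coroot : Fin m → V →ₗ[ℝ] ℝ
  one_le_m : 1 ≤ m
  A_diag : ∀ i, A i i = 2
  A_offdiag : ∀ i j, i ≠ j → A i j ≤ 0
  A_zero_iff : ∀ i j, A i j = 0 ↔ A j i = 0
  root_indep : LinearIndependent ℝ root
  coroot_indep : LinearIndependent ℝ coroot
  pairing : ∀ i j, coroot i (root j) = (A i j : ℝ)
  finDim : FiniteDimensional ℝ V
  dim_eq : finrank ℝ V + (A.map ((↑) : ℤ → ℝ)).rank = 2 * m

/-- A face of a convex set `H`: a convex subset `F ⊆ H` such that whenever the open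
segment between two points of `H` meets `F`, both points lie in `F`. -/
def IsFaceOf {V : Type*} [NormedAddCommGroup V] [NormedSpace ℝ V] (H F : Set V) : Prop :=
  Convex ℝ F ∧ IsExtreme ℝ H F

namespace GCMRealization

variable {m : ℕ} {V : Type*} [NormedAddCommGroup V] [NormedSpace ℝ V]
variable (S : GCMRealization m V)

/-- The fundamental reflection `r_i`. -/
def s (i : Fin m) : V ≃ₗ[ℝ] V :=
  reflEquiv (S.root i) (S.coroot i) (by
    have h := S.pairing i i
    rw [S.A_diag i] at h
    simpa using h)

/-- The Weyl group `W`, as a subgroup of the group of linear automorphisms of `V`. -/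
def W : Subgroup (V ≃ₗ[ℝ] V) := Subgroup.closure (Set.range S.s)

/-- The standard parabolic subgroup `W_I` generated by the reflections indexed by `I`. -/
def WI (I : Set (Fin m)) : Subgroup (V ≃ₗ[ℝ] V) := Subgroup.closure (S.s '' I)

/-- The closed fundamental chamber `C̄`. -/
def chamber : Set V := {η | ∀ i, 0 ≤ S.coroot i η}

/-- `J₀`: the set of indices `i` with `⟨μ, α_i∨⟩ = 0`. -/
def J0 (μ : V) : Set (Fin m) := {i | S.coroot i μ = 0}

/-- The orbit of `μ` under a subgroup of linear automorphisms. -/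
def orbitOf (G : Subgroup (V ≃ₗ[ℝ] V)) (μ : V) : Set V :=
  (fun w : V ≃ₗ[ℝ] V => w μ) '' (G : Set (V ≃ₗ[ℝ] V))

/-- `F_I`: the convex hull of `W_I · μ`. -/
def face (μ : V) (I : Set (Fin m)) : Set V := convexHull ℝ (orbitOf (S.WI I) μ)

/-- `H`: the convex hull of the Weyl group orbit of `μ`. -/
def orbitHull (μ : V) : Set V := convexHull ℝ (orbitOf S.W μ)

/-- `ℝ₊I`: the set of nonnegative linear combinations of the simple roots indexed by `I`. -/
def coneNonneg (I : Set (Fin m)) : Set V :=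
  {v | ∃ c : Fin m → ℝ, (∀ i, 0 ≤ c i) ∧ (∀ i, i ∉ I → c i = 0) ∧ v = ∑ i, c i • S.root i}

/-- `ℝ_>I`: the set of strictly positive linear combinations of the simple roots indexed
by `I` (with `ℝ_>∅ = {0}`). -/
def conePos (I : Set (Fin m)) : Set V :=
  {v | ∃ c : Fin m → ℝ, (∀ i ∈ I, 0 < c i) ∧ (∀ i, i ∉ I → c i = 0) ∧ v = ∑ i, c i • S.root i}

/-- The open standard facet `C_J`. -/
def openFacet (J : Set (Fin m)) : Set V :=
  {η | (∀ i ∈ J, S.coroot i η = 0) ∧ ∀ i, i ∉ J → 0 < S.coroot i η}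

/-- The closed standard facet `C̄_J`. -/
def closedFacet (J : Set (Fin m)) : Set V :=
  {η | (∀ i ∈ J, S.coroot i η = 0) ∧ ∀ i, i ∉ J → 0 ≤ S.coroot i η}

/-- Adjacency of two vertices of the Dynkin diagram: `i ≠ j` and `a_{ij} ≠ 0`
(equivalently `a_{ji} ≠ 0`). -/
def Adjacent (i j : Fin m) : Prop := i ≠ j ∧ S.A i j ≠ 0 ∧ S.A j i ≠ 0

/-- The Dynkin diagram, as a simple graph on the index set. -/
def diagram : SimpleGraph (Fin m) where
  Adj := S.Adjacent
  symm := ⟨fun _ _ h => ⟨h.1.symm, h.2.2, h.2.1⟩⟩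
  loopless := ⟨fun _ h => h.1 rfl⟩

/-- A subset `I` is `μ`-connected if every connected component of `I` meets
`J_> = Π \ J₀` (the empty set is `μ`-connected). -/
def MuConnected (μ : V) (I : Set (Fin m)) : Prop :=
  ∀ i : I, ∃ j : I, S.coroot (j : Fin m) μ ≠ 0 ∧ (S.diagram.induce I).Reachable i j

/-- The connected component of `i` inside `K`, as a subset of the index set. -/
def comp (K : Set (Fin m)) (i : Fin m) : Set (Fin m) :=
  {j | ∃ (hi : i ∈ K) (hj : j ∈ K), (S.diagram.induce K).Reachable ⟨i, hi⟩ ⟨j, hj⟩}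

/-- `I*`: the largest `μ`-connected subset of `I`, i.e. the union of the connected
components of `I` that meet `J_>`. -/
def muPart (μ : V) (I : Set (Fin m)) : Set (Fin m) :=
  {j | ∃ (hj : j ∈ I) (k : Fin m) (hk : k ∈ I), S.coroot k μ ≠ 0 ∧
    (S.diagram.induce I).Reachable ⟨j, hj⟩ ⟨k, hk⟩}

/-- `I_*`: the set of `α ∈ J₀ \ I` orthogonal to all of `I`. -/
def starSet (μ : V) (I : Set (Fin m)) : Set (Fin m) :=
  {i | S.coroot i μ = 0 ∧ i ∉ I ∧ ∀ j ∈ I, S.coroot i (S.root j) = 0}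

/-- A subset `K ⊆ Π` is of finite type if the subgroup `W_K` is finite. -/
def FiniteType (K : Set (Fin m)) : Prop := ((S.WI K : Subgroup (V ≃ₗ[ℝ] V)) : Set (V ≃ₗ[ℝ] V)).Finite

/-- Every connected component of `K` is of finite type. -/
def FinTypeComponents (K : Set (Fin m)) : Prop := ∀ i ∈ K, S.FiniteType (S.comp K i)

/-- A fundamental face of `H`: a face which is empty or whose relative interior meets
the fundamental chamber. -/
def IsFundFace (μ : V) (F : Set V) : Prop :=
  IsFaceOf (S.orbitHull μ) F ∧ (F = ∅ ∨ (intrinsicInterior ℝ F ∩ S.chamber).Nonempty)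

/-- The length of `w ∈ W` with respect to the fundamental reflections. -/
def len (w : V ≃ₗ[ℝ] V) : ℕ :=
  sInf {k | ∃ l : List (Fin m), l.length = k ∧ w = (l.map S.s).prod}

end GCMRealization

end

namespace GCMRealization

section aux

variable {m : ℕ} {V : Type*} [NormedAddCommGroup V] [NormedSpace ℝ V]
variable (S : GCMRealization m V)

lemma s_apply (i : Fin m) (x : V) : S.s i x = x - S.coroot i x • S.root i := rfl

lemma pair_self (i : Fin m) : S.coroot i (S.root i) = 2 := by
  rw [S.pairing, S.A_diag]; norm_num

lemma coroot_s (i j : Fin m) (x : V) :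
    S.coroot i (S.s j x) = S.coroot i x - S.A i j * S.coroot j x := by
  rw [s_apply, map_sub, map_smul, S.pairing, smul_eq_mul]; ring

lemma coroot_s_self (i : Fin m) (x : V) : S.coroot i (S.s i x) = - S.coroot i x := by
  rw [coroot_s, S.A_diag]; push_cast; ring

lemma s_s (i : Fin m) (x : V) : S.s i (S.s i x) = x := by
  rw [s_apply, coroot_s_self, s_apply]; module

lemma s_mul_s (i : Fin m) : S.s i * S.s i = 1 := by
  ext x; exact S.s_s i x

lemma s_mul_cancel (i : Fin m) (w : V ≃ₗ[ℝ] V) : S.s i * (S.s i * w) = w := by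
  rw [← mul_assoc, s_mul_s, one_mul]

lemma s_mem (i : Fin m) : S.s i ∈ S.W := Subgroup.subset_closure ⟨i, rfl⟩

/-! ### Length -/

lemma exists_word {w : V ≃ₗ[ℝ] V} (hw : w ∈ S.W) : ∃ l : List (Fin m), w = (l.map S.s).prod := by
  induction hw using Subgroup.closure_induction_left with
  | one => exact ⟨[], by simp⟩
  | mul_left x hx y hy ih =>
    obtain ⟨i, rfl⟩ := hx
    obtain ⟨l, rfl⟩ := ih
    exact ⟨i :: l, by simp⟩
  | inv_mul_cancel x hx y hy ih =>
    obtain ⟨i, rfl⟩ := hx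
    obtain ⟨l, rfl⟩ := ih
    refine ⟨i :: l, ?_⟩
    rw [inv_eq_of_mul_eq_one_left (S.s_mul_s i)]; simp

lemma len_spec {w : V ≃ₗ[ℝ] V} (hw : w ∈ S.W) :
    ∃ l : List (Fin m), l.length = S.len w ∧ w = (l.map S.s).prod := by
  have : (sInf {k | ∃ l : List (Fin m), l.length = k ∧ w = (l.map S.s).prod}) ∈
      {k | ∃ l : List (Fin m), l.length = k ∧ w = (l.map S.s).prod} := by
    apply Nat.sInf_mem
    obtain ⟨l, hl⟩ := S.exists_word hw
    exact ⟨_, l, rfl, hl⟩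
  exact this

lemma len_le (l : List (Fin m)) : S.len (l.map S.s).prod ≤ l.length :=
  Nat.sInf_le ⟨l, rfl, rfl⟩

lemma len_s_mul {w : V ≃ₗ[ℝ] V} (hw : w ∈ S.W) (i : Fin m) : S.len (S.s i * w) ≤ S.len w + 1 := by
  obtain ⟨l, hl, e⟩ := S.len_spec hw
  have := S.len_le (i :: l)
  rw [List.map_cons, List.prod_cons, ← e, List.length_cons, hl] at this
  exact this

lemma eq_one_of_len {w : V ≃ₗ[ℝ] V} (hw : w ∈ S.W) (h : S.len w = 0) : w = 1 := by
  obtain ⟨l, hl, e⟩ := S.len_spec hw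
  rw [h, List.length_eq_zero_iff] at hl
  subst hl; simpa using e

lemma exists_descent {w : V ≃ₗ[ℝ] V} (hw : w ∈ S.W) {n : ℕ} (h : S.len w = n + 1) :
    ∃ (j : Fin m) (v : V ≃ₗ[ℝ] V), v ∈ S.W ∧ w = S.s j * v ∧ S.len v = n := by
  obtain ⟨l, hl, e⟩ := S.len_spec hw
  cases l with
  | nil => simp at hl; omega
  | cons j t =>
    have hv : (t.map S.s).prod ∈ S.W := by
      apply Subgroup.list_prod_mem
      intro x hx
      obtain ⟨i, -, rfl⟩ := List.mem_map.1 hx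
      exact S.s_mem i
    have e' : w = S.s j * (t.map S.s).prod := by simpa using e
    refine ⟨j, _, hv, e', ?_⟩
    have h1 := S.len_le t
    have h2 := S.len_s_mul hv j
    rw [← e'] at h2
    simp at hl
    omega

/-! ### Alternating words -/

/-- Alternating product `s j * s i * s j * ⋯` with `k` factors. -/
def alt (S : GCMRealization m V) : ℕ → Fin m → Fin m → (V ≃ₗ[ℝ] V)
  | 0, _, _ => 1
  | k + 1, j, i => S.s j * alt S k i j

lemma alt_mem (k : ℕ) (j i : Fin m) : S.alt k j i ∈ S.W := by
  induction k generalizing i j with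
  | zero => exact one_mem _
  | succ k ih => exact mul_mem (S.s_mem j) (ih _ _)

lemma len_alt_mul (k : ℕ) (j i : Fin m) {v : V ≃ₗ[ℝ] V} (hv : v ∈ S.W) :
    S.len (S.alt k j i * v) ≤ k + S.len v := by
  induction k generalizing i j with
  | zero => simp [alt]
  | succ k ih =>
    have := S.len_s_mul (mul_mem (S.alt_mem k i j) hv) j
    rw [← mul_assoc] at this
    have h2 := ih i j
    simp only [alt]
    omega

/-- The letter following an alternating word of length `k`. -/
def nxt : ℕ → Fin m → Fin m → Fin m
  | 0, j, _ => j
  | k + 1, j, i => nxt k i j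

lemma nxt_swap (k : ℕ) (j i : Fin m) :
    (nxt k j i = j ∧ nxt k i j = i) ∨ (nxt k j i = i ∧ nxt k i j = j) := by
  induction k generalizing i j with
  | zero => simp [nxt]
  | succ k ih => 
    have := ih i j
    simp only [nxt]; tauto

lemma alt_succ_right (k : ℕ) (j i : Fin m) :
    S.alt (k + 1) j i = S.alt k j i * S.s (nxt k j i) := by
  induction k generalizing i j with
  | zero => simp [alt, nxt]
  | succ k ih => 
    rw [alt, ih i j, alt, nxt, mul_assoc]

lemma alt_add (k l : ℕ) (j i : Fin m) :
    ∃ j' i', S.alt (k + l) j i = S.alt k j i * S.alt l j' i' := by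
  induction k generalizing i j with
  | zero => exact ⟨j, i, by simp [alt]⟩
  | succ k ih =>
    obtain ⟨j', i', h⟩ := ih i j
    refine ⟨j', i', ?_⟩
    rw [show k + 1 + l = (k + l) + 1 by ring, alt, h, alt, mul_assoc]

lemma braid2 (i j : Fin m) (h1 : S.A i j = 0) (h2 : S.A j i = 0) :
    S.alt 2 j i = S.alt 2 i j := by
  ext x
  simp only [alt, LinearEquiv.mul_apply, LinearEquiv.coe_one, id, s_apply, map_sub, map_smul,
    S.pairing, S.A_diag, h1, h2, smul_eq_mul]
  push_cast
  module

lemma braid3 (i j : Fin m) (h1 : S.A i j = -1) (h2 : S.A j i = -1) :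
    S.alt 3 j i = S.alt 3 i j := by
  ext x
  simp only [alt, LinearEquiv.mul_apply, LinearEquiv.coe_one, id, s_apply, map_sub, map_smul,
    S.pairing, S.A_diag, h1, h2, smul_eq_mul]
  push_cast
  module

lemma braid4 (i j : Fin m) (h1 : S.A i j = -1) (h2 : S.A j i = -2) :
    S.alt 4 j i = S.alt 4 i j := by
  ext x
  simp only [alt, LinearEquiv.mul_apply, LinearEquiv.coe_one, id, s_apply, map_sub, map_smul,
    S.pairing, S.A_diag, h1, h2, smul_eq_mul]
  push_cast
  module

lemma braid6 (i j : Fin m) (h1 : S.A i j = -1) (h2 : S.A j i = -3) :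
    S.alt 6 j i = S.alt 6 i j := by
  ext x
  simp only [alt, LinearEquiv.mul_apply, LinearEquiv.coe_one, id, s_apply, map_sub, map_smul,
    S.pairing, S.A_diag, h1, h2, smul_eq_mul]
  push_cast
  module

lemma alt_big (k : ℕ) (i j : Fin m) (h1 : S.A i j ≤ 0) (h2 : S.A j i ≤ 0)
    (h4 : 4 ≤ S.A i j * S.A j i) (p q : ℝ) (hp : 0 ≤ p) (hq : 0 ≤ q)
    (hpq : 2 * q ≤ -(S.A i j : ℝ) * p) :
    ∃ p' q' : ℝ, 0 ≤ p' ∧ 0 ≤ q' ∧ ∀ x,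
      p * S.coroot i (S.alt k j i x) + q * S.coroot j (S.alt k j i x)
        = p' * S.coroot i x + q' * S.coroot j x := by
  induction k generalizing i j p q with
  | zero => exact ⟨p, q, hp, hq, fun x => rfl⟩
  | succ k ih =>
    have h1' : (S.A i j : ℝ) ≤ 0 := by exact_mod_cast h1
    have h2' : (S.A j i : ℝ) ≤ 0 := by exact_mod_cast h2
    have h4' : (4 : ℝ) ≤ S.A i j * S.A j i := by exact_mod_cast h4
    obtain ⟨p', q', hp', hq', h⟩ := ih j i h2 h1 (by rw [mul_comm]; exact h4)
      (-(S.A i j : ℝ) * p - q) p (by linarith) hp (by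
        nlinarith [mul_le_mul_of_nonneg_left hpq (neg_nonneg.2 h2'),
          mul_le_mul_of_nonneg_right h4' hp])
    refine ⟨q', p', hq', hp', fun x => ?_⟩
    have := h x
    simp only [alt, LinearEquiv.mul_apply]
    rw [coroot_s, coroot_s_self]
    linarith

lemma alt_coroot (i j : Fin m) (hij : i ≠ j) (k : ℕ) :
    (∃ p q : ℝ, 0 ≤ p ∧ 0 ≤ q ∧ ∀ x, S.coroot i (S.alt k j i x)
        = p * S.coroot i x + q * S.coroot j x) ∨
    (∃ n, 1 ≤ n ∧ n ≤ k ∧ S.alt n j i = S.alt n i j) := by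
  have h1 := S.A_offdiag i j hij
  have h2 := S.A_offdiag j i hij.symm
  have h0 := S.A_zero_iff i j
  by_cases h4 : 4 ≤ S.A i j * S.A j i
  · left
    obtain ⟨p, q, hp, hq, h⟩ := S.alt_big k i j h1 h2 h4 1 0 (by norm_num) le_rfl (by
      have : (S.A i j : ℝ) ≤ 0 := by exact_mod_cast h1
      linarith)
    exact ⟨p, q, hp, hq, fun x => by simpa using h x⟩
  have hcases : (S.A i j = 0 ∧ S.A j i = 0) ∨ (S.A i j = -1 ∧ S.A j i = -1) ∨
      (S.A i j = -1 ∧ S.A j i = -2) ∨ (S.A i j = -2 ∧ S.A j i = -1) ∨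
      (S.A i j = -1 ∧ S.A j i = -3) ∨ (S.A i j = -3 ∧ S.A j i = -1) := by
    generalize S.A i j = a at *
    generalize S.A j i = b at *
    by_cases ha : a = 0
    · left; exact ⟨ha, h0.1 ha⟩
    have hb : b ≠ 0 := fun h => ha (h0.2 h)
    have ha3 : -3 ≤ a := by
      by_contra hc
      push Not at hc
      apply h4
      have : b ≤ -1 := by omega
      nlinarith
    have hb3 : -3 ≤ b := by
      by_contra hc
      push Not at hc
      apply h4
      have : a ≤ -1 := by omega
      nlinarith
    clear h0
    interval_cases a <;> interval_cases b <;> simp_all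
  rcases hcases with ⟨e1, e2⟩ | ⟨e1, e2⟩ | ⟨e1, e2⟩ | ⟨e1, e2⟩ | ⟨e1, e2⟩ | ⟨e1, e2⟩
  · by_cases hk : 2 ≤ k
    · exact Or.inr ⟨2, by norm_num, hk, S.braid2 i j e1 e2⟩
    left
    interval_cases k <;> simp only [alt, LinearEquiv.mul_apply, LinearEquiv.coe_one, id,
      coroot_s, S.A_diag, e1, e2]
    · exact ⟨1, 0, by norm_num, by norm_num, fun x => by push_cast; ring⟩
    · exact ⟨1, 0, by norm_num, by norm_num, fun x => by push_cast; ring⟩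
  · by_cases hk : 3 ≤ k
    · exact Or.inr ⟨3, by norm_num, hk, S.braid3 i j e1 e2⟩
    left
    interval_cases k <;> simp only [alt, LinearEquiv.mul_apply, LinearEquiv.coe_one, id,
      coroot_s, S.A_diag, e1, e2]
    · exact ⟨1, 0, by norm_num, by norm_num, fun x => by push_cast; ring⟩
    · exact ⟨1, 1, by norm_num, by norm_num, fun x => by push_cast; ring⟩
    · exact ⟨0, 1, by norm_num, by norm_num, fun x => by push_cast; ring⟩
  · by_cases hk : 4 ≤ k
    · exact Or.inr ⟨4, by norm_num, hk, S.braid4 i j e1 e2⟩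
    left
    interval_cases k <;> simp only [alt, LinearEquiv.mul_apply, LinearEquiv.coe_one, id,
      coroot_s, S.A_diag, e1, e2]
    · exact ⟨1, 0, by norm_num, by norm_num, fun x => by push_cast; ring⟩
    · exact ⟨1, 1, by norm_num, by norm_num, fun x => by push_cast; ring⟩
    · exact ⟨1, 1, by norm_num, by norm_num, fun x => by push_cast; ring⟩
    · exact ⟨1, 0, by norm_num, by norm_num, fun x => by push_cast; ring⟩
  · by_cases hk : 4 ≤ k
    · exact Or.inr ⟨4, by norm_num, hk, (S.braid4 j i e2 e1).symm⟩
    left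
    interval_cases k <;> simp only [alt, LinearEquiv.mul_apply, LinearEquiv.coe_one, id,
      coroot_s, S.A_diag, e1, e2]
    · exact ⟨1, 0, by norm_num, by norm_num, fun x => by push_cast; ring⟩
    · exact ⟨1, 2, by norm_num, by norm_num, fun x => by push_cast; ring⟩
    · exact ⟨1, 2, by norm_num, by norm_num, fun x => by push_cast; ring⟩
    · exact ⟨1, 0, by norm_num, by norm_num, fun x => by push_cast; ring⟩
  · by_cases hk : 6 ≤ k
    · exact Or.inr ⟨6, by norm_num, hk, S.braid6 i j e1 e2⟩
    left
    interval_cases k <;> simp only [alt, LinearEquiv.mul_apply, LinearEquiv.coe_one, id,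
      coroot_s, S.A_diag, e1, e2]
    · exact ⟨1, 0, by norm_num, by norm_num, fun x => by push_cast; ring⟩
    · exact ⟨1, 1, by norm_num, by norm_num, fun x => by push_cast; ring⟩
    · exact ⟨2, 1, by norm_num, by norm_num, fun x => by push_cast; ring⟩
    · exact ⟨2, 1, by norm_num, by norm_num, fun x => by push_cast; ring⟩
    · exact ⟨1, 1, by norm_num, by norm_num, fun x => by push_cast; ring⟩
    · exact ⟨1, 0, by norm_num, by norm_num, fun x => by push_cast; ring⟩
  · by_cases hk : 6 ≤ k
    · exact Or.inr ⟨6, by norm_num, hk, (S.braid6 j i e2 e1).symm⟩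
    left
    interval_cases k <;> simp only [alt, LinearEquiv.mul_apply, LinearEquiv.coe_one, id,
      coroot_s, S.A_diag, e1, e2]
    · exact ⟨1, 0, by norm_num, by norm_num, fun x => by push_cast; ring⟩
    · exact ⟨1, 3, by norm_num, by norm_num, fun x => by push_cast; ring⟩
    · exact ⟨2, 3, by norm_num, by norm_num, fun x => by push_cast; ring⟩
    · exact ⟨2, 3, by norm_num, by norm_num, fun x => by push_cast; ring⟩
    · exact ⟨1, 3, by norm_num, by norm_num, fun x => by push_cast; ring⟩
    · exact ⟨1, 0, by norm_num, by norm_num, fun x => by push_cast; ring⟩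

/-- Tits' lemma. -/
lemma tits (n : ℕ) : ∀ (w : V ≃ₗ[ℝ] V), w ∈ S.W → S.len w = n → ∀ i,
    S.len w ≤ S.len (S.s i * w) → ∀ x ∈ S.chamber, 0 ≤ S.coroot i (w x) := by
  induction n using Nat.strong_induction_on with
  | _ n ih =>
  intro w hw hn i hi x hx
  rcases n with _ | n
  · rw [S.eq_one_of_len hw hn]; exact hx i
  obtain ⟨j, w', hw', rfl, hl'⟩ := S.exists_descent hw hn
  have hij : i ≠ j := by
    rintro rfl
    rw [s_mul_cancel] at hi
    omega
  generalize hwe : S.s j * w' = w at *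
  -- maximal alternating prefix
  obtain ⟨k, ⟨⟨v, hv, hwv, hkv⟩, hk1⟩, hmax⟩ : ∃ k, ((∃ v ∈ S.W, w = S.alt k j i * v ∧
      k + S.len v = S.len w) ∧ 1 ≤ k) ∧ ∀ k', ((∃ v ∈ S.W, w = S.alt k' j i * v ∧
      k' + S.len v = S.len w) ∧ 1 ≤ k') → k' ≤ k := by
    classical
    let P : ℕ → Prop := fun k => (∃ v ∈ S.W, w = S.alt k j i * v ∧
      k + S.len v = S.len w) ∧ 1 ≤ k
    have hP1 : P 1 := ⟨⟨w', hw', by simp [alt, hwe], by omega⟩, le_rfl⟩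
    have hb : ∀ k, P k → k ≤ n + 1 := by
      rintro k ⟨⟨v, -, -, h⟩, -⟩; omega
    refine ⟨Nat.findGreatest P (n + 1), Nat.findGreatest_spec (P := P) (hb 1 hP1) hP1, ?_⟩
    intro k' hk'
    exact Nat.le_findGreatest (hb k' hk') hk'
  obtain ⟨k, rfl⟩ : ∃ k', k = k' + 1 := ⟨k - 1, by omega⟩
  have hnext : S.len v ≤ S.len (S.s (nxt (k + 1) j i) * v) := by
    by_contra hc
    push Not at hc
    set v' := S.s (nxt (k + 1) j i) * v with hv'
    have hv'W : v' ∈ S.W := mul_mem (S.s_mem _) hv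
    have e : w = S.alt (k + 2) j i * v' := by
      rw [alt_succ_right, hwv, hv', mul_assoc, s_mul_cancel]
    have h1 := S.len_alt_mul (k + 2) j i hv'W
    rw [← e] at h1
    have := hmax (k + 2) ⟨⟨v', hv'W, e, by omega⟩, by omega⟩
    omega
  have hprev : S.len v ≤ S.len (S.s (nxt k j i) * v) := by
    have e : w = S.alt k j i * (S.s (nxt k j i) * v) := by
      rw [hwv, alt_succ_right, mul_assoc]
    have h1 := S.len_alt_mul k j i (mul_mem (S.s_mem (nxt k j i)) hv)
    rw [← e] at h1
    omega
  have hvi : S.len v ≤ S.len (S.s i * v) ∧ S.len v ≤ S.len (S.s j * v) := by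
    rw [nxt] at hnext
    rcases nxt_swap k j i with ⟨a, b⟩ | ⟨a, b⟩ <;> rw [a] at hprev <;> rw [b] at hnext <;>
      exact ⟨by assumption, by assumption⟩
  have pi := ih (S.len v) (by omega) v hv rfl i hvi.1 x hx
  have pj := ih (S.len v) (by omega) v hv rfl j hvi.2 x hx
  rcases S.alt_coroot i j hij (k + 1) with ⟨p, q, hp, hq, h⟩ | ⟨N, hN1, hNk, hb⟩
  · rw [hwv, LinearEquiv.mul_apply, h]
    positivity
  · exfalso
    obtain ⟨N, rfl⟩ : ∃ N', N = N' + 1 := ⟨N - 1, by omega⟩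
    obtain ⟨l, hl⟩ := Nat.exists_eq_add_of_le hNk
    obtain ⟨j', i', e⟩ := S.alt_add (N + 1) l j i
    have e2 : S.s i * w = S.alt N j i * (S.alt l j' i' * v) := by
      rw [hwv, hl, e, hb, alt]
      simp only [mul_assoc]
      rw [s_mul_cancel]
    have h1 := S.len_alt_mul l j' i' hv
    have h2 := S.len_alt_mul N j i (mul_mem (S.alt_mem l j' i') hv)
    rw [← e2] at h2
    omega

lemma dichotomy {w : V ≃ₗ[ℝ] V} (hw : w ∈ S.W) (i : Fin m) :
    (∀ x ∈ S.chamber, 0 ≤ S.coroot i (w x)) ∨ (∀ x ∈ S.chamber, S.coroot i (w x) ≤ 0) := by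
  rcases le_total (S.len w) (S.len (S.s i * w)) with h | h
  · left; exact S.tits _ w hw rfl i h
  · right
    intro x hx
    have := S.tits _ (S.s i * w) (mul_mem (S.s_mem i) hw) rfl i (by rwa [s_mul_cancel]) x hx
    rw [LinearEquiv.mul_apply, coroot_s_self] at this
    linarith

/-! ### Half-spaces and finiteness -/

lemma exists_dual : ∃ lam : Fin m → V, ∀ i j, S.coroot i (lam j) = if i = j then 1 else 0 := by
  classical
  haveI := S.finDim
  have hinj : LinearMap.ker (Fintype.linearCombination ℝ S.coroot) = ⊥ :=
    LinearMap.ker_eq_bot.2 S.coroot_indep.fintypeLinearCombination_injective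
  obtain ⟨g, hg⟩ := LinearMap.exists_leftInverse_of_injective _ hinj
  refine ⟨fun j => (Module.evalEquiv ℝ V).symm ((LinearMap.proj j) ∘ₗ g), fun i j => ?_⟩
  have h1 : S.coroot i ((Module.evalEquiv ℝ V).symm ((LinearMap.proj j) ∘ₗ g))
      = ((LinearMap.proj j) ∘ₗ g) (S.coroot i) :=
    Module.apply_evalEquiv_symm_apply (R := ℝ) (M := V) _ _
  have h2 := LinearMap.congr_fun hg (Pi.single i 1)
  simp only [LinearMap.comp_apply, Fintype.linearCombination_apply_single, one_smul,
    LinearMap.id_apply] at h2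
  rw [h1, LinearMap.comp_apply, h2]
  simp [Pi.single_apply, eq_comm]

lemma fixed_of_coroot_zero {w : V ≃ₗ[ℝ] V} (hw : w ∈ S.W) (x : V)
    (hx : ∀ i, S.coroot i x = 0) : w x = x := by
  obtain ⟨l, rfl⟩ := S.exists_word hw
  clear hw
  induction l with
  | nil => rfl
  | cons i t ih =>
    rw [List.map_cons, List.prod_cons, LinearEquiv.mul_apply, ih, s_apply, hx]; simp

lemma coroot_expand {lam : Fin m → V} (hl : ∀ i j, S.coroot i (lam j) = if i = j then 1 else 0)
    {w : V ≃ₗ[ℝ] V} (hw : w ∈ S.W) (i : Fin m) (x : V) :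
    S.coroot i (w x) = ∑ j, S.coroot j x * S.coroot i (w (lam j)) := by
  have h0 : ∀ k, S.coroot k (x - ∑ j, S.coroot j x • lam j) = 0 := by
    intro k
    simp [map_sub, map_sum, hl]
  have h1 := S.fixed_of_coroot_zero hw _ h0
  have h2 : S.coroot i (w (x - ∑ j, S.coroot j x • lam j)) = 0 := by rw [h1, h0]
  simp only [map_sub, map_sum, map_smul, smul_eq_mul] at h2
  linarith

/-- The open negative half-space of `coroot i ∘ w`. -/
def hs (w : V ≃ₗ[ℝ] V) (i : Fin m) : Set V := {x | S.coroot i (w x) < 0}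

/-- The set of negative half-spaces, disjoint from the chamber, containing `y`. -/
def inv (y : V) : Set (Set V) :=
  {D | (∃ w ∈ S.W, ∃ i, D = S.hs w i) ∧ Disjoint D S.chamber ∧ y ∈ D}

lemma hs_preimage (w : V ≃ₗ[ℝ] V) (i j : Fin m) : S.s j ⁻¹' (S.hs w i) = S.hs (w * S.s j) i := rfl

lemma perm_aux {w : V ≃ₗ[ℝ] V} (hw : w ∈ S.W) (k i : Fin m)
    (hd : Disjoint (S.hs w k) S.chamber) (hne : (S.hs w k).Nonempty) (hi : S.hs w k ≠ S.hs 1 i) :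
    Disjoint (S.s i ⁻¹' (S.hs w k)) S.chamber := by
  obtain ⟨lam, hl⟩ := S.exists_dual
  have hpos : ∀ x ∈ S.chamber, 0 ≤ S.coroot k (w x) := by
    intro x hx
    by_contra hc
    push Not at hc
    exact Set.disjoint_left.1 hd hc hx
  rcases S.dichotomy (mul_mem hw (S.s_mem i)) k with h | h
  · rw [hs_preimage, Set.disjoint_left]
    intro x hx hxc
    exact absurd (h x hxc) (not_le.2 hx)
  · exfalso
    have hlam : ∀ j, lam j ∈ S.chamber := by
      intro j i'
      rw [hl]; split_ifs <;> norm_num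
    have hz : ∀ j, j ≠ i → S.coroot k (w (lam j)) = 0 := by
      intro j hj
      have h1 := h _ (hlam j)
      rw [LinearEquiv.mul_apply, s_apply, hl, if_neg (Ne.symm hj), zero_smul, sub_zero] at h1
      exact le_antisymm h1 (hpos _ (hlam j))
    have hφ : ∀ x, S.coroot k (w x) = S.coroot i x * S.coroot k (w (lam i)) := by
      intro x
      rw [S.coroot_expand hl hw k x, Finset.sum_eq_single i]
      · intro j _ hj; rw [hz j hj, mul_zero]
      · simp
    have hc := hpos _ (hlam i)
    rcases hc.eq_or_lt with hc | hc
    · obtain ⟨x, hx⟩ := hne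
      have : S.coroot k (w x) < 0 := hx
      rw [hφ, ← hc, mul_zero] at this
      exact lt_irrefl _ this
    · apply hi
      ext x
      change S.coroot k (w x) < 0 ↔ S.coroot i x < 0
      rw [hφ]
      constructor
      · intro hx; by_contra hcc; push Not at hcc; nlinarith [mul_nonneg hcc hc.le]
      · intro hx; exact mul_neg_of_neg_of_pos hx hc

lemma preimage_preimage_s (i : Fin m) (D : Set V) : S.s i ⁻¹' (S.s i ⁻¹' D) = D := by
  ext x; simp [s_s]

lemma inv_s_subset (i : Fin m) (y : V) :
    ∀ D ∈ S.inv (S.s i y), D ≠ S.hs 1 i → S.s i ⁻¹' D ∈ S.inv y := by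
  rintro D ⟨⟨w, hw, k, rfl⟩, hd, hy⟩ hne
  exact ⟨⟨w * S.s i, mul_mem hw (S.s_mem i), k, rfl⟩, S.perm_aux hw k i hd ⟨_, hy⟩ hne, hy⟩

lemma inv_s_finite (i : Fin m) (y : V) (h : (S.inv y).Finite) : (S.inv (S.s i y)).Finite := by
  apply ((h.image (fun D => S.s i ⁻¹' D)).union (Set.finite_singleton (S.hs 1 i))).subset
  intro D hD
  by_cases hne : D = S.hs 1 i
  · right; exact hne
  · left
    exact ⟨_, S.inv_s_subset i y D hD hne, S.preimage_preimage_s i D⟩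

lemma inv_s_ncard (i : Fin m) (y : V) (h : (S.inv y).Finite) (hy : S.coroot i y < 0) :
    (S.inv (S.s i y)).ncard < (S.inv y).ncard := by
  have hmem : S.hs 1 i ∈ S.inv y := by
    refine ⟨⟨1, one_mem _, i, rfl⟩, ?_, hy⟩
    rw [Set.disjoint_left]
    intro x hx hxc
    exact absurd (hxc i) (not_le.2 hx)
  have hinj : Function.Injective (fun D : Set V => S.s i ⁻¹' D) := by
    intro D E hDE
    have := congrArg (fun D : Set V => S.s i ⁻¹' D) hDE
    simpa only [preimage_preimage_s] using this
  rw [← Set.ncard_image_of_injective _ hinj]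
  apply Set.ncard_lt_ncard _ h
  have hsub : (fun D : Set V => S.s i ⁻¹' D) '' S.inv (S.s i y) ⊆ S.inv y := by
    rintro _ ⟨D, hD, rfl⟩
    apply S.inv_s_subset i y D hD
    rintro rfl
    have : S.coroot i (S.s i y) < 0 := hD.2.2
    rw [coroot_s_self] at this
    linarith
  refine ⟨hsub, fun hc => ?_⟩
  obtain ⟨D, hD, e⟩ := hc hmem
  obtain ⟨lam, hl⟩ := S.exists_dual
  have hlam : lam i ∈ S.chamber := by
    intro i'
    rw [hl]; split_ifs <;> norm_num
  have h1 : D = S.s i ⁻¹' S.hs 1 i := by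
    rw [← e, preimage_preimage_s]
  apply Set.disjoint_left.1 hD.2.1 _ hlam
  rw [h1]
  change S.coroot i (S.s i (lam i)) < 0
  rw [coroot_s_self, hl]; simp

lemma inv_finite {μ : V} (hμ : μ ∈ S.chamber) {y : V} (hy : y ∈ S.orbitHull μ) :
    (S.inv y).Finite := by
  have hconv : Convex ℝ {y | (S.inv y).Finite} := by
    intro x hx y hy a b ha hb hab
    apply (Set.Finite.union hx hy).subset
    rintro D ⟨⟨w, hw, i, rfl⟩, hd, hmem⟩
    by_contra hc
    simp only [Set.mem_union, not_or] at hc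
    have hx' : 0 ≤ S.coroot i (w x) := by
      by_contra h; push Not at h; exact hc.1 ⟨⟨w, hw, i, rfl⟩, hd, h⟩
    have hy' : 0 ≤ S.coroot i (w y) := by
      by_contra h; push Not at h; exact hc.2 ⟨⟨w, hw, i, rfl⟩, hd, h⟩
    have hm : S.coroot i (w (a • x + b • y)) < 0 := hmem
    simp only [map_add, map_smul, smul_eq_mul] at hm
    have := mul_nonneg ha hx'
    have := mul_nonneg hb hy'
    linarith
  refine convexHull_min ?_ hconv hy
  rintro _ ⟨w, hw, rfl⟩
  obtain ⟨l, rfl⟩ := S.exists_word hw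
  clear hw
  induction l with
  | nil =>
    have : S.inv μ = ∅ := by
      rw [Set.eq_empty_iff_forall_notMem]
      rintro D ⟨-, hd, hm⟩
      exact Set.disjoint_left.1 hd hm hμ
    simp [this]
  | cons i t ih => exact S.inv_s_finite i _ ih

/-! ### Faces -/

lemma image_orbitHull (μ : V) {w : V ≃ₗ[ℝ] V} (hw : w ∈ S.W) :
    (fun x => w x) '' S.orbitHull μ = S.orbitHull μ := by
  have h := LinearMap.image_convexHull (𝕜 := ℝ) (w : V →ₗ[ℝ] V) (orbitOf S.W μ)
  change (fun x => w x) '' convexHull ℝ _ = convexHull ℝ ((fun x => w x) '' _) at h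
  rw [orbitHull, h]
  congr 1
  ext x
  constructor
  · rintro ⟨_, ⟨v, hv, rfl⟩, rfl⟩
    exact ⟨w * v, mul_mem hw hv, rfl⟩
  · rintro ⟨v, hv, rfl⟩
    refine ⟨_, ⟨w⁻¹ * v, mul_mem (inv_mem hw) hv, rfl⟩, ?_⟩
    change (w * (w⁻¹ * v)) μ = v μ
    rw [mul_inv_cancel_left]

lemma mul_image (w v : V ≃ₗ[ℝ] V) (F : Set V) :
    (fun x => (w * v) x) '' F = (fun x => w x) '' ((fun x => v x) '' F) := by
  rw [Set.image_image]; rfl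

lemma isFace_image {μ : V} {w : V ≃ₗ[ℝ] V} (hw : w ∈ S.W) {F : Set V}
    (hF : IsFaceOf (S.orbitHull μ) F) : IsFaceOf (S.orbitHull μ) ((fun x => w x) '' F) := by
  refine ⟨hF.1.linear_image (w : V →ₗ[ℝ] V), ?_, ?_⟩
  · rw [← S.image_orbitHull μ hw]; exact Set.image_mono hF.2.subset
  · rw [← S.image_orbitHull μ hw]
    rintro _ ⟨x, hx, rfl⟩ _ ⟨y, hy, rfl⟩ _ ⟨z, hz, rfl⟩ ⟨a, b, ha, hb, hab, e⟩
    refine ⟨x, hF.2.left_mem_of_mem_openSegment hx hy hz ⟨a, b, ha, hb, hab, ?_⟩, rfl⟩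
    apply w.injective
    simpa using e

lemma ri_image (S : GCMRealization m V) (w : V ≃ₗ[ℝ] V) {F : Set V} {x : V}
    (hx : x ∈ intrinsicInterior ℝ F) : w x ∈ intrinsicInterior ℝ ((fun x => w x) '' F) := by
  haveI := S.finDim
  have := AffineEquiv.intrinsicInterior_image (𝕜 := ℝ) w.toAffineEquiv F
  change intrinsicInterior ℝ ((fun x => w x) '' F) = (fun x => w x) '' _ at this
  rw [this]
  exact ⟨x, hx, rfl⟩

end aux

end GCMRealization

lemma ri_extend {V : Type*} [NormedAddCommGroup V] [NormedSpace ℝ V] {F : Set V} {x y : V}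
    (hx : x ∈ intrinsicInterior ℝ F) (hy : y ∈ F) :
    ∃ t : ℝ, 0 < t ∧ x + t • (x - y) ∈ F := by
  obtain ⟨x', hx', rfl⟩ := mem_intrinsicInterior.1 hx
  have hyA : y ∈ affineSpan ℝ F := subset_affineSpan ℝ F hy
  have hmem : ∀ t : ℝ, (x' : V) + t • ((x' : V) - y) ∈ affineSpan ℝ F := by
    intro t
    have := AffineMap.lineMap_mem (-t) x'.2 hyA
    rw [AffineMap.lineMap_apply_module'] at this
    convert this using 1
    module
  let g : ℝ → affineSpan ℝ F := fun t => ⟨_, hmem t⟩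
  have hg : Continuous g := by
    apply Continuous.subtype_mk
    fun_prop
  have hg0 : g 0 = x' := by
    apply Subtype.ext; simp [g]
  have hnhds : g ⁻¹' ((↑) ⁻¹' F) ∈ nhds (0 : ℝ) := by
    apply hg.continuousAt
    rw [hg0]
    exact mem_interior_iff_mem_nhds.1 hx'
  obtain ⟨ε, hε, hb⟩ := Metric.mem_nhds_iff.1 hnhds
  refine ⟨ε / 2, by positivity, ?_⟩
  have : ε / 2 ∈ Metric.ball (0 : ℝ) ε := by
    rw [Metric.mem_ball, dist_zero_right, Real.norm_eq_abs, abs_of_pos (by positivity)]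
    linarith
  exact hb this

lemma face_subset_of_ri {V : Type*} [NormedAddCommGroup V] [NormedSpace ℝ V] {H F G : Set V}
    (hF : F ⊆ H) (hG : IsExtreme ℝ H G) {x : V} (hx : x ∈ intrinsicInterior ℝ F) (hxG : x ∈ G) :
    F ⊆ G := by
  intro y hy
  obtain ⟨t, ht, hz⟩ := ri_extend hx hy
  refine hG.left_mem_of_mem_openSegment (hF hy) (hF hz) hxG
    ⟨t / (1 + t), 1 / (1 + t), by positivity, by positivity, by field_simp; ring, ?_⟩
  match_scalars <;> field_simp <;> ring

namespace GCMRealization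

section aux2

variable {m : ℕ} {V : Type*} [NormedAddCommGroup V] [NormedSpace ℝ V]
variable (S : GCMRealization m V)

lemma s_image_eq_of_subset (i : Fin m) {F : Set V} (h : F ⊆ (fun x => S.s i x) '' F) :
    (fun x => S.s i x) '' F = F := by
  apply Set.Subset.antisymm _ h
  rintro _ ⟨x, hx, rfl⟩
  obtain ⟨y, hy, rfl⟩ := h hx
  simpa [s_s] using hy

lemma s_image_of_zero {μ : V} (i : Fin m) {F : Set V} (hF : IsFaceOf (S.orbitHull μ) F) {x : V}
    (hx : x ∈ intrinsicInterior ℝ F) (h0 : S.coroot i x = 0) :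
    (fun x => S.s i x) '' F = F := by
  apply S.s_image_eq_of_subset
  apply face_subset_of_ri hF.2.subset (S.isFace_image (S.s_mem i) hF).2 hx
  exact ⟨x, intrinsicInterior_subset hx, by simp [s_apply, h0]⟩

lemma s_image_of_neg {μ : V} (i : Fin m) {F : Set V} (hF : IsFaceOf (S.orbitHull μ) F) {x y : V}
    (hx : x ∈ intrinsicInterior ℝ F) (hxp : 0 ≤ S.coroot i x) (hy : y ∈ F)
    (hyn : S.coroot i y < 0) :
    (fun x => S.s i x) '' F = F := by
  rcases hxp.eq_or_lt with h0 | h0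
  · exact S.s_image_of_zero i hF hx h0.symm
  have hxF := intrinsicInterior_subset hx
  apply S.s_image_eq_of_subset
  have hG := S.isFace_image (S.s_mem i) hF
  apply face_subset_of_ri hF.2.subset hG.2 hx
  set p := S.coroot i x with hp
  set q := S.coroot i y with hq
  have hd : 0 < p - q := by linarith
  have ha : 0 < -q / (p - q) := div_pos (by linarith) hd
  have hb : 0 < p / (p - q) := div_pos h0 hd
  have hab : -q / (p - q) + p / (p - q) = 1 := by field_simp; ring
  set z := (-q / (p - q)) • x + (p / (p - q)) • y with hz
  have hzF : z ∈ F := hF.1 hxF hy ha.le hb.le hab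
  have hz0 : S.coroot i z = 0 := by
    rw [hz, map_add, map_smul, map_smul, ← hp, ← hq, smul_eq_mul, smul_eq_mul]
    field_simp; ring
  have hzG : z ∈ (fun x => S.s i x) '' F := ⟨z, hzF, by simp [s_apply, hz0]⟩
  exact hG.2.left_mem_of_mem_openSegment (hF.2.subset hxF) (hF.2.subset hy) hzG
    ⟨_, _, ha, hb, hab, rfl⟩

lemma exists_move {μ : V} (hμ : μ ∈ S.chamber) {F₀ : Set V} (hF : IsFaceOf (S.orbitHull μ) F₀)
    {x : V} (hx : x ∈ intrinsicInterior ℝ F₀) (hxC : x ∈ S.chamber) (n : ℕ) :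
    ∀ y ∈ F₀, (S.inv y).ncard = n →
      ∃ w ∈ S.W, (fun x => w x) '' F₀ = F₀ ∧ w y ∈ S.chamber := by
  induction n using Nat.strong_induction_on with
  | _ n ih =>
  intro y hy hn
  by_cases hyC : y ∈ S.chamber
  · exact ⟨1, one_mem _, by simp, hyC⟩
  · obtain ⟨i, hi⟩ : ∃ i, S.coroot i y < 0 := by
      by_contra hc
      push Not at hc
      exact hyC hc
    have hs := S.s_image_of_neg i hF hx (hxC i) hy hi
    have hlt := S.inv_s_ncard i y (S.inv_finite hμ (hF.2.subset hy)) hi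
    obtain ⟨w, hw, hw1, hw2⟩ := ih _ (by omega) (S.s i y) (by rw [← hs]; exact ⟨y, hy, rfl⟩) rfl
    refine ⟨w * S.s i, mul_mem hw (S.s_mem i), ?_, hw2⟩
    rw [mul_image, hs, hw1]

lemma fund_unique {μ : V} (n : ℕ) : ∀ u ∈ S.W, S.len u = n → ∀ G, IsFaceOf (S.orbitHull μ) G →
    (intrinsicInterior ℝ G ∩ S.chamber).Nonempty →
    (intrinsicInterior ℝ ((fun x => u x) '' G) ∩ S.chamber).Nonempty →
    (fun x => u x) '' G = G := by
  induction n with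
  | zero =>
    intro u hu hl G _ _ _
    rw [S.eq_one_of_len hu hl]; simp
  | succ n ih =>
    intro u hu hl G hG hy hy'
    obtain ⟨j, v, hv, rfl, hlv⟩ := S.exists_descent hu hl
    have hK := S.isFace_image hu hG
    set K := (fun x => (S.s j * v) x) '' G with hKd
    have hsK : (fun x => S.s j x) '' K = K := by
      obtain ⟨y, hyr, hyC⟩ := hy
      obtain ⟨y', hyr', hyC'⟩ := hy'
      have h1 : 0 ≤ S.coroot j (v y) := S.tits _ v hv rfl j (by omega) y hyC
      have h2 : S.coroot j ((S.s j * v) y) = - S.coroot j (v y) := S.coroot_s_self j _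
      have h3 := S.ri_image (S.s j * v) hyr
      rcases h1.eq_or_lt with h0 | h0
      · exact S.s_image_of_zero j hK h3 (by rw [h2, ← h0, neg_zero])
      · exact S.s_image_of_neg j hK hyr' (hyC' j) (intrinsicInterior_subset h3)
          (by rw [h2]; linarith)
    have hvK : (fun x => v x) '' G = K := by
      rw [← hsK, hKd, ← mul_image, s_mul_cancel]
    rw [← hvK] at hy' ⊢
    exact ih v hv hlv G hG hy hy'

end aux2

end GCMRealization

open GCMRealization in
theorem statement_15 {m : ℕ} {V : Type*} [NormedAddCommGroup V] [NormedSpace ℝ V]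
    (S : GCMRealization m V) (μ : V) (hμ : μ ∈ S.chamber)
    (F₀ : Set V) (hF₀ : S.IsFundFace μ F₀)
    (F : Set V) (hF : IsFaceOf (S.orbitHull μ) F) (hsub : F ⊆ F₀) :
    (∃ w : V ≃ₗ[ℝ] V, w ∈ S.W ∧ (fun x => w x) '' F₀ = F₀ ∧
      S.IsFundFace μ ((fun x => w x) '' F) ∧ (fun x => w x) '' F ⊆ F₀) ∧
    (∀ w w' : V ≃ₗ[ℝ] V, w ∈ S.W → (fun x => w x) '' F₀ = F₀ →
      w' ∈ S.W → (fun x => w' x) '' F₀ = F₀ →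
      S.IsFundFace μ ((fun x => w x) '' F) → S.IsFundFace μ ((fun x => w' x) '' F) →
      (fun x => w x) '' F = (fun x => w' x) '' F) := by
  have hF₀f := hF₀.1
  constructor
  · rcases F.eq_empty_or_nonempty with rfl | hne
    · refine ⟨1, one_mem _, by simp, ⟨by simpa using hF, Or.inl (by simp)⟩, by simp⟩
    rcases hF₀.2 with rfl | ⟨x, hx, hxC⟩
    · exact absurd (hne.mono hsub) Set.not_nonempty_empty
    haveI := S.finDim
    obtain ⟨y, hy⟩ := hne.intrinsicInterior hF.1
    obtain ⟨w, hw, h1, h2⟩ := S.exists_move hμ hF₀f hx hxC _ y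
      (hsub (intrinsicInterior_subset hy)) rfl
    refine ⟨w, hw, h1, ⟨S.isFace_image hw hF, Or.inr ⟨w y, S.ri_image w hy, h2⟩⟩, ?_⟩
    exact (Set.image_mono hsub).trans h1.le
  · intro w w' hw _ hw' _ hf hf'
    rcases F.eq_empty_or_nonempty with rfl | hne
    · simp
    have e : (fun x => w' x) '' F = (fun x => (w' * w⁻¹) x) '' ((fun x => w x) '' F) := by
      rw [← mul_image, inv_mul_cancel_right]
    have g := hf.2.resolve_left (hne.image _).ne_empty
    have g' := hf'.2.resolve_left (hne.image _).ne_empty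
    rw [e] at g' ⊢
    exact (S.fund_unique _ _ (mul_mem hw' (inv_mem hw)) rfl _ hf.1 g g').symm
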